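/- arXiv:2602.03475 — 11 statements merged into one kernel-verified Lean document; each statement's English description precedes it below -/
import Mathlib

section
/- Let M be a nonzero left module over a ring such that every nonzero submodule of M contains a uniform submodule. Then M contains an independent family (M_i)_{i∈I} of uniform submodules whose (direct) sum is an essential submodule of M. -/
universe u v

section ModuleDefs

variable {R : Type u} [Ring R] {M : Type v} [AddCommGroup M] [Module R M]

/-- `N` is an essential submodule of `M`: it meets every nonzero submodule nontrivially. -/
def IsEssentialSubmodule (N : Submodule R M) : Prop :=
  ∀ K : Submodule R M, K ≠ ⊥ → N ⊓ K ≠ ⊥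

/-- `N` is an essential submodule of `P`: `N ≤ P` and `N` meets every nonzero submodule
contained in `P` nontrivially. -/
def IsEssentialIn (N P : Submodule R M) : Prop :=
  N ≤ P ∧ ∀ K : Submodule R M, K ≤ P → K ≠ ⊥ → N ⊓ K ≠ ⊥

/-- `U` is a uniform submodule: `U ≠ ⊥` and any two nonzero submodules contained in `U`
intersect nontrivially. -/
def IsUniformSubmodule (U : Submodule R M) : Prop :=
  U ≠ ⊥ ∧ ∀ K L : Submodule R M, K ≤ U → L ≤ U → K ≠ ⊥ → L ≠ ⊥ → K ⊓ L ≠ ⊥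

end ModuleDefs

/-- The uniform (Goldie) dimension of a module: the supremum of the cardinals `#ι` over all
independent families `(f i)_{i : ι}` of nonzero submodules. -/
noncomputable def udim (R : Type u) (M : Type v) [Ring R] [AddCommGroup M] [Module R M] :
    Cardinal.{v} :=
  sSup { c : Cardinal.{v} | ∃ (ι : Type v) (f : ι → Submodule R M),
    iSupIndep f ∧ (∀ i, f i ≠ ⊥) ∧ c = Cardinal.mk ι }

/-- A ring has enough uniform left ideals if every nonzero left ideal contains a uniform
left ideal. -/
def HasEnoughUniformLeftIdeals (T : Type u) [Ring T] : Prop :=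
  ∀ L : Ideal T, L ≠ ⊥ → ∃ U : Ideal T, U ≤ L ∧ IsUniformSubmodule U

/-- The left annihilator of an element, as a left ideal. -/
def lAnn (T : Type u) [Ring T] (x : T) : Ideal T where
  carrier := {t | t * x = 0}
  add_mem' := by
    intro a b ha hb
    simp only [Set.mem_setOf_eq] at *
    rw [add_mul, ha, hb, add_zero]
  zero_mem' := by simp
  smul_mem' := by
    intro c t ht
    simp only [smul_eq_mul, Set.mem_setOf_eq] at *
    rw [mul_assoc, ht, mul_zero]

/-- The left singular ideal of a ring, as a set: the elements whose left annihilator is an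
essential left ideal. -/
def singSet (T : Type u) [Ring T] : Set T := {x | IsEssentialSubmodule (lAnn T x)}

/-- The left annihilator of a set, as a left ideal. -/
def lAnnSet (T : Type u) [Ring T] (U : Set T) : Ideal T where
  carrier := {t | ∀ u ∈ U, t * u = 0}
  add_mem' := by
    intro a b ha hb u hu
    rw [add_mul, ha u hu, hb u hu, add_zero]
  zero_mem' := by intro u hu; simp
  smul_mem' := by
    intro c t ht u hu
    simp only [smul_eq_mul]
    rw [mul_assoc, ht u hu, mul_zero]

/-- The ascending chain condition on left annihilators. -/
def ACCLeftAnnihilators (T : Type u) [Ring T] : Prop :=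
  ∀ f : ℕ → Ideal T, (∀ n, ∃ U : Set T, f n = lAnnSet T U) → Monotone f →
    ∃ n, ∀ m, n ≤ m → f m = f n

/-- A ring is left Goldie if it has finite left uniform dimension (no infinite independent
family of nonzero left ideals) and the ACC on left annihilators. -/
def IsLeftGoldie (T : Type u) [Ring T] : Prop :=
  (¬ ∃ f : ℕ → Ideal T, iSupIndep f ∧ ∀ n, f n ≠ ⊥) ∧ ACCLeftAnnihilators T

/-- A ring is prime: `I·J = 0` forces `I = 0` or `J = 0` for two-sided ideals. -/
def IsPrimeRing (T : Type u) [Ring T] : Prop :=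
  ∀ I J : TwoSidedIdeal T, (∀ x ∈ I, ∀ y ∈ J, x * y = 0) → I = ⊥ ∨ J = ⊥

/-- A ring is semiprime: `I·I = 0` forces `I = 0` for two-sided ideals. -/
def IsSemiprimeRing (T : Type u) [Ring T] : Prop :=
  ∀ I : TwoSidedIdeal T, (∀ x ∈ I, ∀ y ∈ I, x * y = 0) → I = ⊥

section Subring

variable {S : Type u} [Ring S]

/-- A subring `A` of `S`, viewed as a left `A`-submodule of `S`. -/
def Subring.selfSubmodule (A : Subring S) : Submodule A S where
  carrier := A
  add_mem' := by intro a b ha hb; exact add_mem ha hb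
  zero_mem' := zero_mem _
  smul_mem' := by intro a x hx; exact mul_mem a.2 hx

/-- `A` is a nicely essential subring of `S`. -/
def Subring.NicelyEssential (A : Subring S) : Prop :=
  ∀ E : Finset S, (∀ x ∈ E, x ≠ 0) → ∃ a ∈ A, ∀ x ∈ E, a * x ∈ A ∧ a * x ≠ 0

/-- `A` is a strongly nicely essential subring of `S`. -/
def Subring.StronglyNicelyEssential (A : Subring S) : Prop :=
  A.NicelyEssential ∧ ∀ x : S, ∃ c ∈ A, c * x ∈ A ∧ ∀ b ∈ A, b * c = 0 → b = 0

/-- The left annihilator in the subring `A` of an element `x` of the ambient ring,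
as a left ideal of `A`. -/
def Subring.lAnnIn (A : Subring S) (x : S) : Ideal A where
  carrier := {b | (b : S) * x = 0}
  add_mem' := by
    intro a b ha hb
    simp only [Set.mem_setOf_eq] at *
    push_cast
    rw [add_mul, ha, hb, add_zero]
  zero_mem' := by simp
  smul_mem' := by
    intro c t ht
    simp only [smul_eq_mul, Set.mem_setOf_eq] at *
    push_cast
    rw [mul_assoc, ht, mul_zero]

end Subring

/-- Adjoining to an independent set an element disjoint from its supremum gives an
independent set. -/
theorem sSupIndep.insert_of_disjoint {α : Type*} [CompleteLattice α] [IsModularLattice α]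
    {s : Set α} {a : α} (hs : sSupIndep s) (ha : Disjoint a (sSup s)) :
    sSupIndep (insert a s) := by
  intro x hx
  rw [Set.mem_insert_iff] at hx
  obtain rfl | hxa := eq_or_ne x a
  · refine ha.mono_right (sSup_le_sSup ?_)
    rintro y ⟨hy, hne⟩
    exact hy.resolve_left hne
  · have hxs : x ∈ s := hx.resolve_left hxa
    rw [Set.insert_sdiff_of_notMem _ (by simpa using hxa.symm), sSup_insert, sup_comm]
    refine (hs hxs).disjoint_sup_right_of_disjoint_sup_left (ha.symm.mono_left ?_)
    exact sup_le (le_sSup hxs) (sSup_le_sSup Set.sdiff_subset)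

/-- If `M` is a nonzero module in which every nonzero submodule contains a
uniform submodule, then `M` contains an independent family of uniform submodules whose
(direct) sum is an essential submodule of `M`. -/
theorem stmt_0 {R : Type u} [Ring R] {M : Type v} [AddCommGroup M] [Module R M]
    [Nontrivial M]
    (h : ∀ N : Submodule R M, N ≠ ⊥ → ∃ U : Submodule R M, U ≤ N ∧ IsUniformSubmodule U) :
    ∃ (ι : Type v) (f : ι → Submodule R M), iSupIndep f ∧
      (∀ i, IsUniformSubmodule (f i)) ∧ IsEssentialSubmodule (⨆ i, f i) := by
  obtain ⟨s, hs⟩ := zorn_subset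
    {s : Set (Submodule R M) | sSupIndep s ∧ ∀ U ∈ s, IsUniformSubmodule U} fun c hc hchain =>
      ⟨⋃₀ c, ⟨iSupIndep_sUnion_of_directed hchain.directedOn fun t ht => (hc ht).1,
        fun U ⟨t, ht, hU⟩ => (hc ht).2 U hU⟩, fun t ht => Set.subset_sUnion_of_mem ht⟩
  refine ⟨s, (↑), (sSupIndep_iff s).1 hs.prop.1, fun U => hs.prop.2 U U.2, ?_⟩
  intro K hK hbot
  rw [← sSup_eq_iSup'] at hbot
  obtain ⟨U, hUK, hU⟩ := h K hK
  have hdisj : Disjoint U (sSup s) := (disjoint_iff.2 hbot).symm.mono_left hUK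
  have hmem : U ∈ s := hs.le_of_ge
    ⟨hs.prop.1.insert_of_disjoint hdisj, Set.forall_mem_insert.2 ⟨hU, hs.prop.2⟩⟩
    (Set.subset_insert U s) (Set.mem_insert U s)
  exact hU.1 (hdisj.eq_bot_of_le (le_sSup hmem))
end

section
/- Let M be a left module over a ring that contains an essential submodule equal to the direct sum of an independent family (M_i)_{i∈I} of uniform submodules. Then every nonzero submodule of M contains a uniform submodule. -/
universe u v

/-- In a modular lattice, an element between `S` and `F ⊔ S` other than `S` meets `F`. -/
theorem inf_ne_bot_of_le_sup {α : Type*} [Lattice α] [IsModularLattice α] [BoundedOrder α]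
    {F S Y : α} (hSY : S ≤ Y) (hY : Y ≤ F ⊔ S) (hYS : ¬ Y ≤ S) : Y ⊓ F ≠ ⊥ := by
  intro h
  refine hYS ?_
  have key : Y ⊓ F ⊔ S = Y ⊓ (F ⊔ S) := inf_sup_assoc_of_le F hSY
  rw [h, bot_sup_eq, inf_eq_left.2 hY] at key
  exact key.ge

/-- A nonzero submodule of `F ⊔ S` that is disjoint from `S` is uniform if `F` is uniform and
disjoint from `S`. -/
theorem IsUniformSubmodule.of_le_sup {R : Type*} [Ring R] {M : Type*} [AddCommGroup M]
    [Module R M] {F S K : Submodule R M} (hF : IsUniformSubmodule F) (hFS : F ⊓ S = ⊥)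
    (hK : K ≠ ⊥) (hKle : K ≤ F ⊔ S) (hKS : K ⊓ S = ⊥) : IsUniformSubmodule K := by
  have not_le {X : Submodule R M} (hXK : X ≤ K) (hX : X ≠ ⊥) : ¬ X ≤ S := fun h =>
    hX (le_bot_iff.1 (hKS ▸ le_inf hXK h))
  have sup_inf {X : Submodule R M} (hXK : X ≤ K) : (X ⊔ S) ⊓ K = X := by
    rw [sup_inf_assoc_of_le S hXK, inf_comm, hKS, sup_bot_eq]
  have meets {X : Submodule R M} (hXK : X ≤ K) (hX : X ≠ ⊥) : (X ⊔ S) ⊓ F ≠ ⊥ :=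
    inf_ne_bot_of_le_sup le_sup_right (sup_le (hXK.trans hKle) le_sup_right)
      fun h => not_le hXK hX (le_sup_left.trans h)
  refine ⟨hK, fun K₁ K₂ h₁ h₂ hb₁ hb₂ => ?_⟩
  have hne := hF.2 _ _ inf_le_right inf_le_right (meets h₁ hb₁) (meets h₂ hb₂)
  have hY : ¬ (K₁ ⊔ S) ⊓ (K₂ ⊔ S) ≤ S := fun h => hne <| le_bot_iff.1 <| hFS ▸
    le_inf (inf_le_left.trans inf_le_right)
      ((inf_le_inf inf_le_left inf_le_left).trans h)
  have := inf_ne_bot_of_le_sup (F := K) (le_inf le_sup_right le_sup_right)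
    (inf_le_left.trans (sup_le_sup_right h₁ S)) hY
  rwa [inf_inf_distrib_right, sup_inf h₁, sup_inf h₂] at this

/-- A submodule meeting a finite subsum of an independent family of uniform submodules contains
a uniform submodule. -/
theorem exists_isUniformSubmodule_le_of_inf_finset_sup_ne_bot {R : Type*} [Ring R] {M : Type*}
    [AddCommGroup M] [Module R M] {ι : Type*} {f : ι → Submodule R M} (hind : iSupIndep f)
    (huni : ∀ i, IsUniformSubmodule (f i)) (s : Finset ι) (N : Submodule R M)
    (hN : N ⊓ s.sup f ≠ ⊥) : ∃ U ≤ N, IsUniformSubmodule U := by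
  classical
  induction s using Finset.induction_on with
  | empty => simp at hN
  | insert a s ha ih =>
    by_cases h : N ⊓ s.sup f = ⊥
    · rw [Finset.sup_insert] at hN
      have hdisj : Disjoint (f a) (s.sup f) := (hind a).mono_right <| Finset.sup_le fun i hi =>
        le_iSup₂_of_le i (ne_of_mem_of_not_mem hi ha) le_rfl
      exact ⟨_, inf_le_left, (huni a).of_le_sup hdisj.eq_bot hN inf_le_right
        (le_bot_iff.1 (h ▸ inf_le_inf_right _ inf_le_left))⟩
    · exact ih h

/-- If `M` contains an essential submodule which is the direct sum of an
independent family of uniform submodules, then every nonzero submodule of `M` contains a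
uniform submodule. -/
theorem stmt_1 {R : Type u} [Ring R] {M : Type v} [AddCommGroup M] [Module R M]
    {ι : Type w} (f : ι → Submodule R M) (hind : iSupIndep f)
    (huni : ∀ i, IsUniformSubmodule (f i)) (hess : IsEssentialSubmodule (⨆ i, f i)) :
    ∀ N : Submodule R M, N ≠ ⊥ → ∃ U : Submodule R M, U ≤ N ∧ IsUniformSubmodule U := by
  intro N hN
  obtain ⟨x, hx, hx0⟩ := Submodule.exists_mem_ne_zero_of_ne_bot (hess N hN)
  obtain ⟨s, hs⟩ := Submodule.exists_finset_of_mem_iSup f hx.1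
  refine exists_isUniformSubmodule_le_of_inf_finset_sup_ne_bot hind huni s N fun h => hx0 ?_
  rw [← Finset.sup_eq_iSup] at hs
  exact (Submodule.mem_bot R).1 (h ▸ ⟨hx.2, hs⟩)
end

section
/- Let M be a left module over a ring that contains an essential submodule equal to the direct sum of an independent family (M_i)_{i∈I} of uniform submodules. Then every independent family (N_s)_{s∈I'} of nonzero submodules of M satisfies |I'| ≤ |I| (cardinality); consequently udim(M) = |I|. -/
universe u v

section ModularLattice

variable {α : Type*} [Lattice α] [OrderBot α] [IsModularLattice α]

/-- Adjoining to `b` an element `u` whose nonzero minorants pairwise meet, the disjointness of `b`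
from a finite independent family survives after discarding at most one member of the family. -/
theorem Finset.SupIndep.exists_subset_card_le_add_one_disjoint_sup {κ : Type*} {g : κ → α}
    {T : Finset κ} (hg : T.SupIndep g) {b u : α}
    (hu : ∀ x y, x ≤ u → y ≤ u → x ≠ ⊥ → y ≠ ⊥ → x ⊓ y ≠ ⊥) (hbu : Disjoint b u)
    (hb : Disjoint b (T.sup g)) :
    ∃ T' ⊆ T, T.card ≤ T'.card + 1 ∧ Disjoint (b ⊔ u) (T'.sup g) := by
  classical
  obtain ⟨T', hT', hmax⟩ := (T.powerset.filter fun A => Disjoint (b ⊔ u) (A.sup g)).exists_maximal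
    ⟨∅, by simp⟩
  simp only [Finset.mem_filter, Finset.mem_powerset] at hT' hmax
  refine ⟨T', hT'.1, ?_, hT'.2⟩
  suffices h : (T \ T').card ≤ 1 by
    have := Finset.card_sdiff_add_card_eq_card hT'.1
    omega
  have meets : ∀ s ∈ T \ T', u ⊓ (b ⊔ (insert s T').sup g) ≠ ⊥ := by
    intro s hs h
    rw [Finset.mem_sdiff] at hs
    have hsub : insert s T' ⊆ T := Finset.insert_subset hs.1 hT'.1
    refine hs.2 (hmax ⟨hsub, ?_⟩ (Finset.subset_insert s T') (Finset.mem_insert_self s T'))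
    rw [sup_comm]
    exact (hb.mono_right (Finset.sup_mono hsub)).disjoint_sup_left_of_disjoint_sup_right
      (disjoint_iff.2 h)
  rw [Finset.card_le_one]
  intro s hs t ht
  by_contra hst
  refine hu _ _ inf_le_left inf_le_left (meets s hs) (meets t ht) ?_
  rw [Finset.mem_sdiff] at hs ht
  rw [← inf_inf_distrib_left]
  have hsub : insert t T' ⊆ T := Finset.insert_subset ht.1 hT'.1
  have hs' : s ∉ insert t T' := by simp [hs.2, hst]
  have hgs : Disjoint (g s) ((insert t T').sup g) := hg hsub hs.1 hs'
  have hC : Disjoint (g s) (b ⊔ (insert t T').sup g) := by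
    rw [sup_comm]
    refine hgs.disjoint_sup_right_of_disjoint_sup_left ?_
    rw [← Finset.sup_insert]
    exact (hb.mono_right (Finset.sup_mono (Finset.insert_subset hs.1 hsub))).symm
  have hmeet : (b ⊔ (insert s T').sup g) ⊓ (b ⊔ (insert t T').sup g) = b ⊔ T'.sup g := by
    have hle : b ⊔ T'.sup g ≤ b ⊔ (insert t T').sup g :=
      sup_le_sup_left (Finset.sup_mono (Finset.subset_insert t T')) b
    rw [Finset.sup_insert (b := s), sup_left_comm, sup_comm (g s), sup_inf_assoc_of_le _ hle,
      hC.eq_bot, sup_bot_eq]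
  rw [hmeet, ← disjoint_iff]
  refine hbu.symm.disjoint_sup_right_of_disjoint_sup_left ?_
  simpa only [sup_comm] using hT'.right

/-- An independent family of nonzero elements below the join of a finite independent family of
uniform elements has at most as many members. -/
theorem Finset.SupIndep.card_le_card_of_sup_le_sup {ι κ : Type*} {f : ι → α} {g : κ → α}
    {J : Finset ι} {T : Finset κ} (hf : J.SupIndep f) (hg : T.SupIndep g)
    (hu : ∀ i ∈ J, ∀ x y, x ≤ f i → y ≤ f i → x ≠ ⊥ → y ≠ ⊥ → x ⊓ y ≠ ⊥)
    (hne : ∀ t ∈ T, g t ≠ ⊥) (hle : T.sup g ≤ J.sup f) : T.card ≤ J.card := by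
  classical
  have key : ∀ A ⊆ J, ∃ T' ⊆ T, T.card ≤ T'.card + A.card ∧ Disjoint (A.sup f) (T'.sup g) := by
    intro A
    induction A using Finset.induction_on with
    | empty => exact fun _ => ⟨T, subset_rfl, by simp, by simp⟩
    | insert i A hi ih =>
      intro hA
      obtain ⟨hiJ, hAJ⟩ := Finset.insert_subset_iff.1 hA
      obtain ⟨T₁, hT₁, hcard₁, hdisj₁⟩ := ih hAJ
      obtain ⟨T₂, hT₂, hcard₂, hdisj₂⟩ :=
        (hg.subset hT₁).exists_subset_card_le_add_one_disjoint_sup (hu i hiJ)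
          (hf hAJ hiJ hi).symm hdisj₁
      refine ⟨T₂, hT₂.trans hT₁, ?_, ?_⟩
      · rw [Finset.card_insert_of_notMem hi]
        omega
      · rwa [Finset.sup_insert, sup_comm]
  obtain ⟨T', hT', hcard, hdisj⟩ := key J subset_rfl
  have hbot : T'.sup g = ⊥ := hdisj.symm.eq_bot_of_le ((Finset.sup_mono hT').trans hle)
  have hempty : T' = ∅ := Finset.eq_empty_of_forall_notMem fun t ht =>
    hne t (hT' ht) (le_bot_iff.1 (hbot ▸ Finset.le_sup ht))
  simpa [hempty] using hcard

end ModularLattice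

/-- An independent family of nonzero submodules is at most as large as an independent family of
uniform submodules with essential sum. -/
theorem iSupIndep.exists_injective_of_isEssentialSubmodule {R : Type u} [Ring R] {M : Type v}
    [AddCommGroup M] [Module R M] {ι κ : Type*} {f : ι → Submodule R M}
    (hind : iSupIndep f) (huni : ∀ i, IsUniformSubmodule (f i))
    (hess : IsEssentialSubmodule (⨆ i, f i)) {g : κ → Submodule R M} (hg : iSupIndep g)
    (hne : ∀ s, g s ≠ ⊥) : ∃ φ : κ → ι, Function.Injective φ := by
  classical
  choose x hx hx0 using fun s => Submodule.exists_mem_ne_zero_of_ne_bot (hess (g s) (hne s))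
  choose F hF using fun s => (Submodule.mem_iSup_iff_exists_finset).1 (hx s).1
  have hspan : iSupIndep fun s => Submodule.span R {x s} :=
    hg.mono fun s => (Submodule.span_singleton_le_iff_mem _ _).2 (hx s).2
  obtain ⟨φ, hφ, -⟩ := (Finset.all_card_le_biUnion_card_iff_exists_injective F).1 fun T =>
    (hind.supIndep' (T.biUnion F)).card_le_card_of_sup_le_sup (hspan.supIndep' T)
      (fun i _ => (huni i).2) (fun s _ => mt Submodule.span_singleton_eq_bot.1 (hx0 s)) <|
      Finset.sup_le fun s hs => by
        refine le_trans ?_ (Finset.sup_mono (Finset.subset_biUnion_of_mem F hs))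
        rw [Submodule.span_singleton_le_iff_mem, Finset.sup_eq_iSup]
        exact hF s
  exact ⟨φ, hφ⟩

/-- If `M` contains an essential submodule which is the direct sum of an
independent family `(f i)_{i : ι}` of uniform submodules, then every independent family of
nonzero submodules of `M` has cardinality at most `#ι`; consequently `udim M = #ι`. -/
theorem stmt_2 {R : Type u} [Ring R] {M : Type v} [AddCommGroup M] [Module R M]
    {ι : Type v} (f : ι → Submodule R M) (hind : iSupIndep f)
    (huni : ∀ i, IsUniformSubmodule (f i)) (hess : IsEssentialSubmodule (⨆ i, f i)) :
    (∀ (ι' : Type v) (g : ι' → Submodule R M), iSupIndep g → (∀ s, g s ≠ ⊥) →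
        Cardinal.mk ι' ≤ Cardinal.mk ι) ∧
    udim R M = Cardinal.mk ι := by
  have hle : ∀ (ι' : Type v) (g : ι' → Submodule R M), iSupIndep g → (∀ s, g s ≠ ⊥) →
      Cardinal.mk ι' ≤ Cardinal.mk ι := fun ι' g hg hne =>
    let ⟨φ, hφ⟩ := hind.exists_injective_of_isEssentialSubmodule huni hess hg hne
    Cardinal.mk_le_of_injective hφ
  refine ⟨hle, IsGreatest.csSup_eq ⟨⟨ι, f, hind, fun i => (huni i).1, rfl⟩, ?_⟩⟩
  rintro c ⟨ι', g, hg, hne, rfl⟩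
  exact hle ι' g hg hne
end

section
/- Let S be a ring, R a subring of S, and A a subring of S (subrings contain 1). For a left ideal L of R let AL denote the left A-submodule of S generated by L. Assume: (i) for every nonzero left ideal L of R, A ∩ AL is an essential left A-submodule of AL; and (ii) for all left ideals L, L' of R with L ∩ L' = 0 one has AL ∩ AL' = 0. Then udim(R) ≤ udim(A), where udim denotes left uniform dimension. -/
universe u v

theorem bddAbove_mk_iSupIndep (R : Type u) (M : Type v) [Ring R] [AddCommGroup M] [Module R M] :
    BddAbove { c : Cardinal.{v} | ∃ (ι : Type v) (f : ι → Submodule R M),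
      iSupIndep f ∧ (∀ i, f i ≠ ⊥) ∧ c = Cardinal.mk ι } := by
  refine ⟨Cardinal.mk (Set M), ?_⟩
  rintro c ⟨ι, f, hf, hne, rfl⟩
  exact Cardinal.mk_le_of_injective (f := fun i => (f i : Set M))
    (SetLike.coe_injective.comp (hf.injective hne))

theorem mk_le_udim {R : Type u} {M : Type v} [Ring R] [AddCommGroup M] [Module R M]
    {ι : Type v} {f : ι → Submodule R M} (hf : iSupIndep f) (hne : ∀ i, f i ≠ ⊥) :
    Cardinal.mk ι ≤ udim R M :=
  le_csSup (bddAbove_mk_iSupIndep R M) ⟨ι, f, hf, hne, rfl⟩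

namespace Subring

variable {S : Type u} [Ring S] (A : Subring S) {R : Subring S}

/-- The left ideal `A ∩ AL` of `A`, for a left ideal `L` of `R`. -/
def interSpan (L : Ideal R) : Ideal A :=
  (Submodule.span A (Subtype.val '' (L : Set R))).comap (LinearMap.toSpanSingleton A S 1)

variable {A}

theorem mem_interSpan {L : Ideal R} {a : A} :
    a ∈ A.interSpan L ↔ (a : S) ∈ Submodule.span A (Subtype.val '' (L : Set R)) := by
  simp [interSpan, Subring.smul_def]

theorem interSpan_mono {L L' : Ideal R} (h : L ≤ L') : A.interSpan L ≤ A.interSpan L' :=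
  Submodule.comap_mono (Submodule.span_mono (Set.image_mono h))

theorem disjoint_interSpan {L L' : Ideal R}
    (h : Submodule.span A (Subtype.val '' (L : Set R)) ⊓
      Submodule.span A (Subtype.val '' (L' : Set R)) = ⊥) :
    Disjoint (A.interSpan L) (A.interSpan L') := by
  rw [Submodule.disjoint_def]
  intro a ha ha'
  have : (a : S) ∈ (⊥ : Submodule A S) := h ▸ ⟨mem_interSpan.1 ha, mem_interSpan.1 ha'⟩
  exact Subtype.ext this

theorem interSpan_ne_bot {L : Ideal R} (hL : L ≠ ⊥)
    (h : IsEssentialIn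
      (A.selfSubmodule ⊓ Submodule.span A (Subtype.val '' (L : Set R)))
      (Submodule.span A (Subtype.val '' (L : Set R)))) :
    A.interSpan L ≠ ⊥ := by
  obtain ⟨x, hx, hx0⟩ := Submodule.exists_mem_ne_zero_of_ne_bot hL
  have hspan : Submodule.span A (Subtype.val '' (L : Set R)) ≠ ⊥ :=
    (Submodule.ne_bot_iff _).2
      ⟨x, Submodule.subset_span ⟨x, hx, rfl⟩, fun h0 => hx0 (Subtype.ext h0)⟩
  obtain ⟨y, ⟨⟨hyA, hy⟩, -⟩, hy0⟩ :=
    Submodule.exists_mem_ne_zero_of_ne_bot (h.2 _ le_rfl hspan)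
  exact (Submodule.ne_bot_iff _).2
    ⟨⟨y, hyA⟩, mem_interSpan.2 hy, fun h0 => hy0 (congrArg Subtype.val h0)⟩

end Subring

/-- Let `R`, `A` be subrings of `S`. If (i) for every nonzero left ideal
`L` of `R` the left ideal `A ∩ AL` is an essential left `A`-submodule of `AL`, and
(ii) `AL ∩ AL' = 0` whenever `L ∩ L' = 0`, then `udim R ≤ udim A` (left uniform
dimensions of the rings). -/
theorem stmt_3 {S : Type u} [Ring S] (R A : Subring S)
    (h1 : ∀ L : Ideal R, L ≠ ⊥ →
      IsEssentialIn
        (A.selfSubmodule ⊓ Submodule.span A (Subtype.val '' (L : Set R)))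
        (Submodule.span A (Subtype.val '' (L : Set R))))
    (h2 : ∀ L L' : Ideal R, L ⊓ L' = ⊥ →
      Submodule.span A (Subtype.val '' (L : Set R)) ⊓
        Submodule.span A (Subtype.val '' (L' : Set R)) = ⊥) :
    udim ↥R ↥R ≤ udim ↥A ↥A := by
  refine csSup_le' ?_
  rintro c ⟨ι, f, hf, hne, rfl⟩
  refine mk_le_udim (f := fun i => A.interSpan (f i)) (fun i => ?_)
    (fun i => Subring.interSpan_ne_bot (hne i) (h1 _ (hne i)))
  exact (Subring.disjoint_interSpan (h2 _ _ (hf i).eq_bot)).mono_right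
    (iSup₂_le fun j hj => Subring.interSpan_mono (le_iSup₂_of_le j hj le_rfl))
end

section
/- Let S be a ring, R a subring of S, and A a subring of S. For a left ideal L of R let AL denote the left A-submodule of S generated by L. Assume: (i) for every nonzero left ideal L of R, A ∩ AL is an essential left A-submodule of AL; (ii) AL ∩ AL' = 0 whenever L, L' are left ideals of R with L ∩ L' = 0; (iii) for every uniform left ideal L of R, A ∩ AL is a uniform left ideal of A; and (iv) for every essential left ideal L of R, A ∩ AL is an essential left ideal of A. If R has enough uniform left ideals, then A has enough uniform left ideals and udim(A) = udim(R). -/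
universe u v

section ModularLattice

variable {α : Type*} [Lattice α] [OrderBot α] [IsModularLattice α] {W X P Z : α}

theorem sup_inf_ne_bot_of_le_sup (hX : X ≠ ⊥) (hXP : X ≤ W ⊔ P) (hXW : X ⊓ W = ⊥) :
    (W ⊔ X) ⊓ P ≠ ⊥ := by
  intro h
  have e : (W ⊔ P) ⊓ (W ⊔ X) = W := by
    rw [sup_inf_assoc_of_le P le_sup_left, inf_comm, h, sup_bot_eq]
  have hle : X ≤ W := e ▸ le_inf hXP le_sup_right
  exact hX (by rwa [inf_eq_left.2 hle] at hXW)

theorem sup_inf_sup_eq_left (h : X ⊓ (W ⊔ Z) = ⊥) : (W ⊔ X) ⊓ (W ⊔ Z) = W := by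
  rw [sup_inf_assoc_of_le X le_sup_left, h, sup_bot_eq]

end ModularLattice

section UniformFamilies

variable {R : Type u} [Ring R] {M : Type v} [AddCommGroup M] [Module R M]

theorem exists_finset_inf_sup_ne_bot {ι : Type*} {V : ι → Submodule R M} {K : Submodule R M}
    (h : K ⊓ ⨆ i, V i ≠ ⊥) : ∃ F : Finset ι, K ⊓ F.sup V ≠ ⊥ := by
  obtain ⟨x, ⟨hxK, hxV⟩, hx⟩ := (Submodule.ne_bot_iff _).1 h
  obtain ⟨F, hF⟩ := Submodule.mem_iSup_iff_exists_finset.1 hxV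
  rw [← Finset.sup_eq_iSup] at hF
  exact ⟨F, (Submodule.ne_bot_iff _).2 ⟨x, ⟨hxK, hF⟩, hx⟩⟩

theorem finset_sup_le_iSup {ι : Type*} (V : ι → Submodule R M) (F : Finset ι) :
    F.sup V ≤ ⨆ i, V i :=
  Finset.sup_le fun i _ => le_iSup V i

theorem iSupIndep.disjoint_finset_sup {ι : Type*} {V : ι → Submodule R M} (hV : iSupIndep V)
    {F : Finset ι} {i : ι} (hi : i ∉ F) : Disjoint (V i) (F.sup V) := by
  rw [Finset.sup_eq_iSup]
  exact hV.disjoint_biSup (y := (F : Set ι)) hi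

/-- If two submodules of `W ⊔ V` with `V` uniform are both disjoint from `W`, then either they
meet or their sum meets `W`. -/
theorem IsUniformSubmodule.inf_ne_bot_or_sup_inf_ne_bot {V W X Y : Submodule R M}
    (hV : IsUniformSubmodule V) (hVW : Disjoint V W) (hX : X ≠ ⊥) (hY : Y ≠ ⊥)
    (hXle : X ≤ W ⊔ V) (hYle : Y ≤ W ⊔ V) : X ⊓ Y ≠ ⊥ ∨ (X ⊔ Y) ⊓ W ≠ ⊥ := by
  by_contra! hcon
  obtain ⟨hXY, hW⟩ := hcon
  have hXW : X ⊓ W = ⊥ := le_bot_iff.1 (hW ▸ inf_le_inf_right W le_sup_left)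
  have hYW : Y ⊓ W = ⊥ := le_bot_iff.1 (hW ▸ inf_le_inf_right W le_sup_right)
  have hdis : X ⊓ (W ⊔ Y) = ⊥ := by
    rw [sup_comm W Y]
    exact ((disjoint_iff.2 hXY).disjoint_sup_right_of_disjoint_sup_left (disjoint_iff.2 hW)).eq_bot
  refine hV.2 _ _ inf_le_right inf_le_right (sup_inf_ne_bot_of_le_sup hX hXle hXW)
    (sup_inf_ne_bot_of_le_sup hY hYle hYW) ?_
  rw [← inf_inf_distrib_right, sup_inf_sup_eq_left hdis, inf_comm]
  exact hVW.eq_bot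

theorem IsEssentialIn.trans {N P Q : Submodule R M} (h : IsEssentialIn N P)
    (h' : IsEssentialIn P Q) : IsEssentialIn N Q := by
  refine ⟨h.1.trans h'.1, fun K hK hK0 => ?_⟩
  have := h.2 (P ⊓ K) inf_le_left (h'.2 K hK hK0)
  rwa [← inf_assoc, inf_eq_left.2 h.1] at this

theorem IsEssentialIn.sup_left {N P W : Submodule R M} (h : IsEssentialIn N P)
    (hPW : Disjoint P W) : IsEssentialIn (W ⊔ N) (W ⊔ P) := by
  refine ⟨sup_le_sup_left h.1 W, fun X hX hX0 hcon => ?_⟩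
  have hXW : X ⊓ W = ⊥ := by
    rw [inf_comm]
    exact le_bot_iff.1 (hcon ▸ inf_le_inf_right X le_sup_left)
  have hXN : X ⊓ (W ⊔ N) = ⊥ := by rwa [inf_comm]
  have hZ := h.2 _ inf_le_right (sup_inf_ne_bot_of_le_sup hX0 hX hXW)
  refine hZ (le_bot_iff.1 ?_)
  rw [← hPW.eq_bot]
  refine le_inf (inf_le_right.trans inf_le_right) ?_
  exact (le_inf (inf_le_right.trans inf_le_left) (inf_le_left.trans le_sup_right)).trans
    (sup_inf_sup_eq_left hXN).le

theorem IsEssentialIn.sup {N₁ P₁ N₂ P₂ : Submodule R M} (h₁ : IsEssentialIn N₁ P₁)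
    (h₂ : IsEssentialIn N₂ P₂) (hd : Disjoint P₁ P₂) : IsEssentialIn (N₁ ⊔ N₂) (P₁ ⊔ P₂) := by
  have e := h₁.sup_left (W := N₂) (hd.mono_right h₂.1)
  rw [sup_comm N₂, sup_comm N₂] at e
  exact e.trans (h₂.sup_left hd.symm)

theorem IsEssentialIn.finset_sup {ι : Type*} {N P : ι → Submodule R M}
    (h : ∀ i, IsEssentialIn (N i) (P i)) (hP : iSupIndep P) (F : Finset ι) :
    IsEssentialIn (F.sup N) (F.sup P) := by
  classical
  induction F using Finset.induction_on with
  | empty => exact ⟨le_rfl, fun K hK hK0 => absurd (le_bot_iff.1 hK) hK0⟩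
  | insert i F hi ih =>
    rw [Finset.sup_insert, Finset.sup_insert]
    exact (h i).sup ih (hP.disjoint_finset_sup hi)

theorem IsEssentialIn.iSup {ι : Type*} {N P : ι → Submodule R M}
    (h : ∀ i, IsEssentialIn (N i) (P i)) (hP : iSupIndep P) :
    IsEssentialIn (⨆ i, N i) (⨆ i, P i) := by
  refine ⟨iSup_mono fun i => (h i).1, fun K hK hK0 hcon => ?_⟩
  obtain ⟨F, hF⟩ := exists_finset_inf_sup_ne_bot (K := K) (V := P) (by rwa [inf_eq_left.2 hK])
  refine (IsEssentialIn.finset_sup h hP F).2 _ inf_le_right hF (le_bot_iff.1 ?_)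
  rw [← hcon]
  exact inf_le_inf (finset_sup_le_iSup N F) inf_le_left

/-- A submodule meeting the sum of an independent family of uniform submodules
nontrivially contains a uniform submodule. -/
theorem exists_isUniformSubmodule_le {ι : Type*} {V : ι → Submodule R M} (hV : iSupIndep V)
    (hu : ∀ i, IsUniformSubmodule (V i)) {K : Submodule R M} (hK : K ⊓ ⨆ i, V i ≠ ⊥) :
    ∃ U ≤ K, IsUniformSubmodule U := by
  classical
  obtain ⟨F, hF⟩ := exists_finset_inf_sup_ne_bot hK
  induction F using Finset.induction_on with
  | empty => simp at hF
  | insert i F hi ih =>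
    by_cases hF' : K ⊓ F.sup V = ⊥
    · refine ⟨_, inf_le_left, hF, fun X Y hX hY hX0 hY0 => ?_⟩
      rw [Finset.sup_insert, sup_comm] at hX hY
      refine ((hu i).inf_ne_bot_or_sup_inf_ne_bot (hV.disjoint_finset_sup hi) hX0 hY0
        (hX.trans inf_le_right) (hY.trans inf_le_right)).resolve_right fun h => h ?_
      rw [← le_bot_iff, ← hF']
      exact inf_le_inf_right _ (sup_le (hX.trans inf_le_left) (hY.trans inf_le_left))
    · exact ih hF'

theorem iSupIndep.inf_sup_subtype_ne {ι : Type*} {Y : ι → Submodule R M} (hY : iSupIndep Y)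
    {b : ι} {W : Submodule R M} (hb : Y b ⊓ W = ⊥) :
    iSupIndep fun j : {j // j ≠ b} => (Y b ⊔ Y j) ⊓ W := by
  intro j
  have hQ : Y j ⊓ (Y b ⊔ ⨆ k : {k // k ≠ b}, ⨆ _ : k ≠ j, Y k) = ⊥ := by
    refine ((hY j).mono_right (sup_le ?_ ?_)).eq_bot
    · exact le_iSup₂_of_le b j.2.symm le_rfl
    · exact iSup₂_le fun k hk => le_iSup₂_of_le k.1 (fun h => hk (Subtype.ext h)) le_rfl
  have hle : (⨆ k : {k // k ≠ b}, ⨆ _ : k ≠ j, (Y b ⊔ Y k) ⊓ W) ≤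
      Y b ⊔ ⨆ k : {k // k ≠ b}, ⨆ _ : k ≠ j, Y k :=
    iSup₂_le fun k hk => inf_le_left.trans
      (sup_le_sup_left (le_iSup₂ (f := fun (k : {k // k ≠ b}) (_ : k ≠ j) => Y k) k hk) _)
  refine disjoint_iff_inf_le.2 (le_trans (le_inf ?_ (inf_le_left.trans inf_le_right)) hb.le)
  exact (inf_le_inf inf_le_left hle).trans (sup_inf_sup_eq_left hQ).le

theorem iSupIndep.mk_le_finset_card {ι : Type*} {V : ι → Submodule R M} (hV : iSupIndep V)
    (hu : ∀ i, IsUniformSubmodule (V i)) (F : Finset ι) {J : Type*} {Y : J → Submodule R M}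
    (hY : iSupIndep Y) (hY0 : ∀ j, Y j ≠ ⊥) (hle : ∀ j, Y j ≤ F.sup V) :
    Cardinal.mk J ≤ F.card := by
  classical
  induction F using Finset.induction_on generalizing J with
  | empty =>
    have : IsEmpty J := ⟨fun j => hY0 j (by simpa using hle j)⟩
    simp
  | insert i F hi ih =>
    rw [Finset.card_insert_of_notMem hi]
    by_cases hall : ∀ j, Y j ⊓ F.sup V ≠ ⊥
    · refine (ih (hY.mono fun j => inf_le_left) hall fun j => inf_le_right).trans ?_
      exact_mod_cast Nat.le_succ _
    · push Not at hall
      obtain ⟨b, hb⟩ := hall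
      have hle' : ∀ j, Y j ≤ F.sup V ⊔ V i := fun j => by
        simpa [sup_comm] using hle j
      have hcard := ih (hY.inf_sup_subtype_ne hb) (fun j => ?_) (fun j => inf_le_right)
      · have := Cardinal.mk_sum_compl ({b} : Set J)
        rw [← this, Cardinal.mk_singleton, add_comm]
        push_cast
        exact add_le_add_left hcard 1
      · refine ((hu i).inf_ne_bot_or_sup_inf_ne_bot (hV.disjoint_finset_sup hi) (hY0 b) (hY0 j)
          (hle' b) (hle' j)).resolve_left fun h => h ?_
        exact (hY.pairwiseDisjoint j.2.symm).eq_bot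

theorem iSupIndep.mk_le_mk_of_isEssentialSubmodule {ι J : Type v} {V : ι → Submodule R M}
    (hV : iSupIndep V) (hu : ∀ i, IsUniformSubmodule (V i))
    (hess : IsEssentialSubmodule (⨆ i, V i)) {Y : J → Submodule R M} (hY : iSupIndep Y)
    (hY0 : ∀ j, Y j ≠ ⊥) : Cardinal.mk J ≤ Cardinal.mk ι := by
  have hmeet : ∀ j, Y j ⊓ ⨆ i, V i ≠ ⊥ := fun j => by
    rw [inf_comm]
    exact hess _ (hY0 j)
  rcases finite_or_infinite ι with hfin | hinf
  · have := Fintype.ofFinite ι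
    rw [Cardinal.mk_fintype ι]
    refine hV.mk_le_finset_card hu Finset.univ (hY.mono fun j => inf_le_left) hmeet fun j => ?_
    rw [Finset.sup_univ_eq_iSup]
    exact inf_le_right
  · choose F hF using fun j => exists_finset_inf_sup_ne_bot (hmeet j)
    have hfib : ∀ G : Finset ι, Cardinal.mk (F ⁻¹' {G}) ≤ Cardinal.aleph0 := fun G => by
      refine le_trans (hV.mk_le_finset_card hu G
        (Y := fun j : F ⁻¹' {G} => Y j ⊓ (F j).sup V)
        ((hY.comp Subtype.val_injective).mono fun j => inf_le_left) (fun j => hF j)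
        fun j => ?_) (Cardinal.natCast_lt_aleph0).le
      have hj : F j = G := j.2
      rw [hj]
      exact inf_le_right
    have h := Cardinal.mk_le_mk_mul_of_mk_preimage_le F hfib
    rwa [Cardinal.mk_finset_of_infinite,
      Cardinal.mul_eq_left (Cardinal.aleph0_le_mk ι) (Cardinal.aleph0_le_mk ι)
        Cardinal.aleph0_ne_zero] at h

theorem udim_eq_mk {ι : Type v} {V : ι → Submodule R M} (hV : iSupIndep V)
    (hu : ∀ i, IsUniformSubmodule (V i)) (hess : IsEssentialSubmodule (⨆ i, V i)) :
    udim R M = Cardinal.mk ι := by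
  refine IsGreatest.csSup_eq ⟨⟨ι, V, hV, fun i => (hu i).1, rfl⟩, ?_⟩
  rintro _ ⟨J, Y, hY, hY0, rfl⟩
  exact hV.mk_le_mk_of_isEssentialSubmodule hu hess hY hY0

theorem sSupIndep.insert_of_disjoint_s4 {s : Set (Submodule R M)} (hs : sSupIndep s)
    {U : Submodule R M} (hU : Disjoint (sSup s) U) : sSupIndep (insert U s) := by
  intro x hx
  by_cases hxU : x = U
  · subst hxU
    refine hU.symm.mono_right (sSup_le_sSup ?_)
    rintro y ⟨rfl | hy, hne⟩
    · exact absurd rfl hne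
    · exact hy
  · have hxs : x ∈ s := hx.resolve_left hxU
    have hle : sSup (insert U s \ {x}) ≤ sSup (s \ {x}) ⊔ U := by
      refine sSup_le ?_
      rintro y ⟨rfl | hy, hne⟩
      · exact le_sup_right
      · exact (le_sSup (show y ∈ s \ {x} from ⟨hy, hne⟩)).trans le_sup_left
    refine ((hs hxs).disjoint_sup_right_of_disjoint_sup_left (hU.mono_left ?_)).mono_right hle
    exact sup_le (le_sSup hxs) (sSup_le_sSup Set.sdiff_subset)

/-- If every nonzero submodule contains a uniform one, some independent family of uniform
submodules has an essential sum. -/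
theorem exists_sSupIndep_uniform_essential
    (h : ∀ L : Submodule R M, L ≠ ⊥ → ∃ U ≤ L, IsUniformSubmodule U) :
    ∃ s : Set (Submodule R M), sSupIndep s ∧ (∀ U ∈ s, IsUniformSubmodule U) ∧
      IsEssentialSubmodule (sSup s) := by
  obtain ⟨s, hs⟩ := zorn_subset
    {s : Set (Submodule R M) | sSupIndep s ∧ ∀ U ∈ s, IsUniformSubmodule U} fun c hc hchain =>
      ⟨⋃₀ c, ⟨iSupIndep_sUnion_of_directed hchain.directedOn fun t ht => (hc ht).1,
        fun U ⟨t, ht, hU⟩ => (hc ht).2 U hU⟩, fun _ => Set.subset_sUnion_of_mem⟩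
  refine ⟨s, hs.prop.1, hs.prop.2, fun K hK hcon => ?_⟩
  obtain ⟨U, hUK, hU⟩ := h K hK
  have hdis : Disjoint (sSup s) U := (disjoint_iff.2 hcon).mono_right hUK
  have hmem : U ∈ s := hs.le_of_ge
    (show insert U s ∈ _ from ⟨hs.prop.1.insert_of_disjoint_s4 hdis, by
      rintro V (rfl | hV)
      exacts [hU, hs.prop.2 V hV]⟩)
    (Set.subset_insert U s) (Set.mem_insert U s)
  exact hU.1 (disjoint_self.1 (hdis.mono_left (le_sSup hmem)))

end UniformFamilies

section Comap

variable {R : Type*} [Ring R] {M N : Type*} [AddCommGroup M] [Module R M]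
  [AddCommGroup N] [Module R N] {f : M →ₗ[R] N}

theorem Submodule.map_ne_bot_of_injective (hf : Function.Injective f) {K : Submodule R M}
    (hK : K ≠ ⊥) : K.map f ≠ ⊥ := fun h =>
  hK (Submodule.map_injective_of_injective hf (by rw [h, Submodule.map_bot]))

theorem IsUniformSubmodule.comap (hf : Function.Injective f) {V : Submodule R N}
    (hV : IsUniformSubmodule V) (hr : V ≤ LinearMap.range f) :
    IsUniformSubmodule (V.comap f) := by
  refine ⟨fun h => hV.1 ?_, fun K L hK hL hK0 hL0 h => ?_⟩
  · rw [← Submodule.map_comap_eq_self hr, h, Submodule.map_bot]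
  · refine hV.2 (K.map f) (L.map f) (Submodule.map_le_iff_le_comap.2 hK)
      (Submodule.map_le_iff_le_comap.2 hL) (Submodule.map_ne_bot_of_injective hf hK0)
      (Submodule.map_ne_bot_of_injective hf hL0) ?_
    rw [← Submodule.map_inf f hf, h, Submodule.map_bot]

theorem iSupIndep.comap_of_injective (hf : Function.Injective f) {ι : Type*}
    {V : ι → Submodule R N} (hV : iSupIndep V) : iSupIndep fun i => (V i).comap f := by
  intro i
  rw [disjoint_iff, ← le_bot_iff, ← Submodule.comap_bot f |>.trans (LinearMap.ker_eq_bot.2 hf),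
    ← (hV i).eq_bot, Submodule.comap_inf]
  exact inf_le_inf_left _ (iSup₂_le fun k hk => Submodule.comap_mono (le_iSup₂_of_le k hk le_rfl))

theorem IsEssentialIn.iSup_comap (hf : Function.Injective f) {ι : Type*} {V : ι → Submodule R N}
    (h : IsEssentialIn (⨆ i, V i) (LinearMap.range f)) :
    IsEssentialSubmodule (⨆ i, (V i).comap f) := by
  intro K hK hcon
  have hmap : (⨆ i, (V i).comap f).map f = ⨆ i, V i := by
    rw [Submodule.map_iSup]
    exact iSup_congr fun i => Submodule.map_comap_eq_self ((le_iSup V i).trans h.1)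
  refine h.2 (K.map f) LinearMap.map_le_range (Submodule.map_ne_bot_of_injective hf hK) ?_
  rw [← hmap, ← Submodule.map_inf f hf, hcon, Submodule.map_bot]

end Comap

section SubringSpan

variable {S : Type u} [Ring S]

/-- The inclusion of a subring into the ambient ring, as a left linear map. -/
def Subring.inclusionLinearMap (A : Subring S) : A →ₗ[A] S where
  toFun := Subtype.val
  map_add' _ _ := rfl
  map_smul' _ _ := rfl

theorem Subring.range_inclusionLinearMap (A : Subring S) :
    LinearMap.range A.inclusionLinearMap = A.selfSubmodule :=
  SetLike.coe_injective Subtype.range_coe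

theorem Subring.span_image_iSup (R A : Subring S) {ι : Sort*} (U : ι → Ideal R) :
    Submodule.span A (Subtype.val '' ((⨆ i, U i : Ideal R) : Set R)) =
      ⨆ i, Submodule.span A (Subtype.val '' (U i : Set R)) := by
  refine le_antisymm (Submodule.span_le.2 ?_)
    (iSup_le fun i => Submodule.span_mono (Set.image_mono (le_iSup U i)))
  rintro _ ⟨x, hx, rfl⟩
  refine Submodule.iSup_induction U (motive := fun y : R =>
    (y : S) ∈ ⨆ i, Submodule.span A (Subtype.val '' (U i : Set R))) hx
    (fun i y hy => ?_) (zero_mem _) fun y z hy hz => add_mem hy hz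
  exact Submodule.mem_iSup_of_mem i (Submodule.subset_span ⟨y, hy, rfl⟩)

end SubringSpan

/-- Let `R`, `A` be subrings of `S` satisfying conditions (i)-(iv).
If `R` has enough uniform left ideals, then so does `A`, and `udim A = udim R`. -/
theorem stmt_4 {S : Type u} [Ring S] (R A : Subring S)
    (h1 : ∀ L : Ideal R, L ≠ ⊥ →
      IsEssentialIn
        (A.selfSubmodule ⊓ Submodule.span A (Subtype.val '' (L : Set R)))
        (Submodule.span A (Subtype.val '' (L : Set R))))
    (h2 : ∀ L L' : Ideal R, L ⊓ L' = ⊥ →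
      Submodule.span A (Subtype.val '' (L : Set R)) ⊓
        Submodule.span A (Subtype.val '' (L' : Set R)) = ⊥)
    (h3 : ∀ L : Ideal R, IsUniformSubmodule L →
      IsUniformSubmodule
        (A.selfSubmodule ⊓ Submodule.span A (Subtype.val '' (L : Set R))))
    (h4 : ∀ L : Ideal R, IsEssentialSubmodule L →
      IsEssentialIn
        (A.selfSubmodule ⊓ Submodule.span A (Subtype.val '' (L : Set R)))
        A.selfSubmodule)
    (hR : HasEnoughUniformLeftIdeals ↥R) :
    HasEnoughUniformLeftIdeals ↥A ∧ udim ↥A ↥A = udim ↥R ↥R := by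
  obtain ⟨s, hs, hsU, hsE⟩ := exists_sSupIndep_uniform_essential hR
  have hU : iSupIndep ((↑) : s → Ideal R) := (sSupIndep_iff s).1 hs
  rw [sSup_eq_iSup'] at hsE
  let P : s → Submodule A S := fun i => Submodule.span A (Subtype.val '' ((i : Ideal R) : Set R))
  have hP : iSupIndep P := fun i => by
    have := h2 i (⨆ (j) (_ : j ≠ i), (j : Ideal R)) (hU i).eq_bot
    simp only [Subring.span_image_iSup] at this
    exact disjoint_iff.2 this
  have hNP : ∀ i : s, IsEssentialIn (A.selfSubmodule ⊓ P i) (P i) := fun i =>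
    h1 i (hsU i i.2).1
  have hsup := IsEssentialIn.iSup hNP hP
  have hE := h4 _ hsE
  rw [Subring.span_image_iSup] at hE
  have hf : Function.Injective A.inclusionLinearMap := Subtype.val_injective
  have hess : IsEssentialIn (⨆ i, A.selfSubmodule ⊓ P i) A.selfSubmodule := by
    refine ⟨iSup_le fun i => inf_le_left, fun K hK hK0 hcon => ?_⟩
    refine hsup.2 _ (inf_le_left.trans inf_le_right) (hE.2 K hK hK0) (le_bot_iff.1 ?_)
    rw [← hcon]
    exact inf_le_inf_left _ inf_le_right
  rw [← A.range_inclusionLinearMap] at hess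
  have hAE := IsEssentialIn.iSup_comap hf hess
  have hAI := (hP.mono fun i => inf_le_right (a := A.selfSubmodule)).comap_of_injective hf
  have hAU : ∀ i : s, IsUniformSubmodule
      ((A.selfSubmodule ⊓ P i).comap A.inclusionLinearMap) := fun i =>
    (h3 i (hsU i i.2)).comap hf (by rw [A.range_inclusionLinearMap]; exact inf_le_left)
  rw [A.range_inclusionLinearMap] at hAE
  refine ⟨fun L hL => exists_isUniformSubmodule_le hAI hAU ?_, ?_⟩
  · rw [inf_comm]
    exact hAE L hL
  · rw [udim_eq_mk hAI hAU hAE, udim_eq_mk hU (fun i => hsU i i.2) hsE]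
end

section
/- Let A be a nicely essential subring of a ring S. Then: (i) for all left ideals L, L' of A with L ∩ L' = 0, the left ideals SL and SL' of S generated by L and L' satisfy SL ∩ SL' = 0; (ii) udim(S) = udim(A) (left uniform dimensions); and (iii) sing(A) = A ∩ sing(S). -/
universe u v

namespace Subring

variable {S : Type u} [Ring S] {A : Subring S}

/-- An element of the left ideal of `S` generated by a left ideal `L` of `A` is multiplied into `L`
by every element of `A` which multiplies a suitable finite subset of `S` into `A`. -/
theorem exists_finset_mul_mem_of_mem_span (L : Ideal A) {y : S}
    (hy : y ∈ Submodule.span S (Subtype.val '' (L : Set A))) :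
    ∃ E : Finset S, ∀ a ∈ A, (∀ s ∈ E, a * s ∈ A) → ∃ l ∈ L, (l : S) = a * y := by
  classical
  induction hy using Submodule.span_induction with
  | mem y hy =>
    obtain ⟨l, hl, rfl⟩ := hy
    exact ⟨∅, fun a ha _ => ⟨⟨a, ha⟩ * l, L.mul_mem_left _ hl, rfl⟩⟩
  | zero => exact ⟨∅, fun a _ _ => ⟨0, L.zero_mem, by simp⟩⟩
  | add y z _ _ hy hz =>
    obtain ⟨E, hE⟩ := hy
    obtain ⟨F, hF⟩ := hz
    refine ⟨E ∪ F, fun a ha h => ?_⟩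
    obtain ⟨l, hl, hly⟩ := hE a ha fun s hs => h s (Finset.mem_union_left _ hs)
    obtain ⟨m, hm, hmz⟩ := hF a ha fun s hs => h s (Finset.mem_union_right _ hs)
    exact ⟨l + m, L.add_mem hl hm, by simp [hly, hmz, mul_add]⟩
  | smul s y _ hy =>
    obtain ⟨E, hE⟩ := hy
    refine ⟨insert s (E.image (s * ·)), fun a ha h => ?_⟩
    obtain ⟨l, hl, hly⟩ := hE (a * s) (h s (Finset.mem_insert_self _ _)) fun e he => by
      rw [mul_assoc]
      exact h _ (Finset.mem_insert_of_mem (Finset.mem_image_of_mem _ he))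
    exact ⟨l, hl, by rw [hly, smul_eq_mul, mul_assoc]⟩

namespace NicelyEssential

theorem exists_mul_mem (hA : A.NicelyEssential) (E : Finset S) {y : S} (hy : y ≠ 0) :
    ∃ a ∈ A, (∀ s ∈ E, a * s ∈ A) ∧ a * y ≠ 0 := by
  classical
  obtain ⟨a, ha, h⟩ := hA (insert y (E.filter (· ≠ 0))) (by
    intro x hx
    rcases Finset.mem_insert.1 hx with rfl | hx
    · exact hy
    · exact (Finset.mem_filter.1 hx).2)
  refine ⟨a, ha, fun s hs => ?_, (h y (Finset.mem_insert_self _ _)).2⟩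
  by_cases hs0 : s = 0
  · simp [hs0, A.zero_mem]
  · exact (h s (Finset.mem_insert_of_mem (Finset.mem_filter.2 ⟨hs, hs0⟩))).1

theorem span_inf_span_eq_bot (hA : A.NicelyEssential) {L L' : Ideal A} (h : L ⊓ L' = ⊥) :
    Submodule.span S (Subtype.val '' (L : Set A)) ⊓
      Submodule.span S (Subtype.val '' (L' : Set A)) = ⊥ := by
  classical
  rw [eq_bot_iff]
  rintro y ⟨hy, hy'⟩
  rw [Submodule.mem_bot]
  by_contra hy0
  obtain ⟨E, hE⟩ := exists_finset_mul_mem_of_mem_span L hy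
  obtain ⟨F, hF⟩ := exists_finset_mul_mem_of_mem_span L' hy'
  obtain ⟨a, ha, haE, hay⟩ := hA.exists_mul_mem (E ∪ F) hy0
  obtain ⟨l, hl, hly⟩ := hE a ha fun s hs => haE s (Finset.mem_union_left _ hs)
  obtain ⟨m, hm, hmy⟩ := hF a ha fun s hs => haE s (Finset.mem_union_right _ hs)
  obtain rfl : l = m := Subtype.ext (hly.trans hmy.symm)
  have hl0 : l ∈ L ⊓ L' := ⟨hl, hm⟩
  rw [h, Submodule.mem_bot] at hl0
  exact hay (by rw [← hly, hl0, ZeroMemClass.coe_zero])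

theorem comap_ne_bot (hA : A.NicelyEssential) {K : Ideal S} (hK : K ≠ ⊥) :
    Ideal.comap A.subtype K ≠ ⊥ := by
  obtain ⟨x, hx, hx0⟩ := Submodule.exists_mem_ne_zero_of_ne_bot hK
  obtain ⟨a, -, h⟩ := hA {x} (by simpa using hx0)
  obtain ⟨hax, hax0⟩ := h x (Finset.mem_singleton_self x)
  refine (Submodule.ne_bot_iff _).2 ⟨⟨a * x, hax⟩, K.mul_mem_left a hx, fun h0 => hax0 ?_⟩
  exact congrArg Subtype.val h0

theorem iSupIndep_span (hA : A.NicelyEssential) {ι : Type*} {f : ι → Ideal A} (hf : iSupIndep f) :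
    iSupIndep fun i => Submodule.span S (Subtype.val '' (f i : Set A)) := by
  intro i
  refine (disjoint_iff.2 (hA.span_inf_span_eq_bot (disjoint_iff.1 (hf i)))).mono_right ?_
  exact iSup₂_le fun j hj => Submodule.span_mono
    (Set.image_mono (SetLike.coe_subset_coe.2 (le_iSup₂_of_le j hj le_rfl)))

end NicelyEssential

theorem span_image_val_ne_bot {L : Ideal A} (hL : L ≠ ⊥) :
    Submodule.span S (Subtype.val '' (L : Set A)) ≠ ⊥ := by
  obtain ⟨x, hx, hx0⟩ := Submodule.exists_mem_ne_zero_of_ne_bot hL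
  exact (Submodule.ne_bot_iff _).2 ⟨x, Submodule.subset_span ⟨x, hx, rfl⟩,
    fun h => hx0 (Subtype.ext h)⟩

theorem iSupIndep_comap_subtype {ι : Type*} {f : ι → Ideal S} (hf : iSupIndep f) :
    iSupIndep fun i => Ideal.comap A.subtype (f i) := by
  intro i
  rw [Submodule.disjoint_def]
  intro x hx hx'
  have hle : ⨆ (j) (_ : j ≠ i), Ideal.comap A.subtype (f j) ≤
      Ideal.comap A.subtype (⨆ (j) (_ : j ≠ i), f j) :=
    iSup₂_le fun j hj => Ideal.comap_mono (le_iSup₂_of_le j hj le_rfl)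
  exact Subtype.ext (Submodule.disjoint_def.1 (hf i) x hx (hle hx'))

namespace NicelyEssential

theorem udim_eq (hA : A.NicelyEssential) : udim S S = udim A A := by
  unfold udim
  congr 1
  ext c
  constructor
  · rintro ⟨ι, f, hf, hf0, rfl⟩
    exact ⟨ι, _, iSupIndep_comap_subtype hf, fun i => hA.comap_ne_bot (hf0 i), rfl⟩
  · rintro ⟨ι, f, hf, hf0, rfl⟩
    exact ⟨ι, _, hA.iSupIndep_span hf, fun i => span_image_val_ne_bot (hf0 i), rfl⟩

theorem mem_singSet_iff (hA : A.NicelyEssential) (x : A) :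
    x ∈ singSet A ↔ (x : S) ∈ singSet S := by
  constructor
  · intro hx K hK
    obtain ⟨y, ⟨hyx, hyK⟩, hy0⟩ :=
      Submodule.exists_mem_ne_zero_of_ne_bot (hx _ (hA.comap_ne_bot hK))
    exact (Submodule.ne_bot_iff _).2 ⟨y, ⟨congrArg Subtype.val hyx, hyK⟩,
      fun h => hy0 (Subtype.ext h)⟩
  · intro hx L hL
    obtain ⟨y, ⟨hyx, hyL⟩, hy0⟩ :=
      Submodule.exists_mem_ne_zero_of_ne_bot (hx _ (span_image_val_ne_bot hL))
    obtain ⟨E, hE⟩ := exists_finset_mul_mem_of_mem_span L hyL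
    obtain ⟨a, ha, haE, hay⟩ := hA.exists_mul_mem E hy0
    obtain ⟨l, hl, hly⟩ := hE a ha haE
    have hyx' : y * (x : S) = 0 := hyx
    have hlx : l * x = 0 := Subtype.ext (by
      rw [MulMemClass.coe_mul, hly, mul_assoc, hyx', mul_zero, ZeroMemClass.coe_zero])
    refine (Submodule.ne_bot_iff _).2 ⟨l, ⟨hlx, hl⟩, fun h => hay ?_⟩
    rw [← hly, h, ZeroMemClass.coe_zero]

end NicelyEssential

end Subring

/-- For a nicely essential subring `A` of `S`: (i) left ideals of `A` with
zero intersection generate left ideals of `S` with zero intersection; (ii) the left uniform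
dimensions of `S` and `A` coincide; (iii) `sing A = A ∩ sing S`. -/
theorem stmt_5 {S : Type u} [Ring S] (A : Subring S) (hA : A.NicelyEssential) :
    (∀ L L' : Ideal A, L ⊓ L' = ⊥ →
      Submodule.span S (Subtype.val '' (L : Set A)) ⊓
        Submodule.span S (Subtype.val '' (L' : Set A)) = ⊥) ∧
    udim S S = udim ↥A ↥A ∧
    Subtype.val '' singSet ↥A = (A : Set S) ∩ singSet S := by
  refine ⟨fun L L' h => hA.span_inf_span_eq_bot h, hA.udim_eq, ?_⟩
  ext x
  constructor
  · rintro ⟨y, hy, rfl⟩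
    exact ⟨y.2, (hA.mem_singSet_iff y).1 hy⟩
  · rintro ⟨hxA, hx⟩
    exact ⟨⟨x, hxA⟩, (hA.mem_singSet_iff ⟨x, hxA⟩).2 hx, rfl⟩
end

section
/- Let A be a nicely essential subring of a ring S and let L be a nonzero left A-submodule of S. Then A ∩ L is a uniform left ideal of A if and only if the left ideal SL of S generated by L is a uniform left ideal of S; and A ∩ L is an essential left ideal of A if and only if SL is an essential left ideal of S. -/
universe u v

section NicelyEssential

variable {S : Type u} [Ring S] {A : Subring S}

/-- Membership of `x` in the left ideal generated by an `A`-submodule `X` is witnessed by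
finitely many coefficients: clearing them moves `x` into `X`. -/
theorem Subring.exists_finset_mul_mem_of_mem_span_s6 (X : Submodule A S) {x : S}
    (hx : x ∈ Submodule.span S (X : Set S)) (s : S) :
    ∃ E : Finset S, ∀ a ∈ A, (∀ e ∈ E, a * e ∈ A) → a * (s * x) ∈ X := by
  classical
  induction hx using Submodule.span_induction generalizing s with
  | mem x hx =>
    refine ⟨{s}, fun a _ h => ?_⟩
    rw [← mul_assoc]
    exact X.smul_mem (⟨a * s, h s (Finset.mem_singleton_self s)⟩ : A) hx
  | zero => exact ⟨∅, fun a _ _ => by simp⟩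
  | add x y _ _ ihx ihy =>
    obtain ⟨E, hE⟩ := ihx s
    obtain ⟨F, hF⟩ := ihy s
    refine ⟨E ∪ F, fun a ha h => ?_⟩
    rw [mul_add, mul_add]
    exact X.add_mem (hE a ha fun e he => h e (Finset.mem_union_left F he))
      (hF a ha fun e he => h e (Finset.mem_union_right E he))
  | smul t x _ ih =>
    obtain ⟨E, hE⟩ := ih (s * t)
    exact ⟨E, fun a ha h => by simpa [mul_assoc] using hE a ha h⟩

/-- A nonzero element common to the left ideals generated by `X` and `Y` has a nonzero
`A`-multiple in `A ∩ X ∩ Y`. -/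
theorem Subring.NicelyEssential.exists_mul_mem_s6 (hA : A.NicelyEssential)
    {X Y : Submodule A S} {x : S} (hX : x ∈ Submodule.span S (X : Set S))
    (hY : x ∈ Submodule.span S (Y : Set S)) (hx : x ≠ 0) :
    ∃ a ∈ A, a * x ∈ A ∧ a * x ∈ X ∧ a * x ∈ Y ∧ a * x ≠ 0 := by
  classical
  obtain ⟨E, hE⟩ := Subring.exists_finset_mul_mem_of_mem_span_s6 X hX 1
  obtain ⟨F, hF⟩ := Subring.exists_finset_mul_mem_of_mem_span_s6 Y hY 1
  obtain ⟨a, ha, h⟩ := hA ((insert x (E ∪ F)).erase 0) fun y hy => Finset.ne_of_mem_erase hy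
  have key : ∀ e ∈ insert x (E ∪ F), a * e ∈ A := fun e he => by
    by_cases h0 : e = 0
    · simp [h0]
    · exact (h e (Finset.mem_erase.2 ⟨h0, he⟩)).1
  refine ⟨a, ha, key x (by simp), ?_, ?_, (h x (by simp [hx])).2⟩
  · simpa using hE a ha fun e he => key e (by simp [he])
  · simpa using hF a ha fun e he => key e (by simp [he])

theorem Subring.NicelyEssential.inf_ne_bot (hA : A.NicelyEssential) {X Y : Submodule A S}
    (h : Submodule.span S (X : Set S) ⊓ Submodule.span S (Y : Set S) ≠ ⊥) : X ⊓ Y ≠ ⊥ := by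
  obtain ⟨x, ⟨hX, hY⟩, hx⟩ := Submodule.exists_mem_ne_zero_of_ne_bot h
  obtain ⟨a, -, -, haX, haY, h0⟩ := hA.exists_mul_mem_s6 hX hY hx
  exact (Submodule.ne_bot_iff _).2 ⟨a * x, ⟨haX, haY⟩, h0⟩

/-- A nonzero left ideal of `S` inside the left ideal generated by `X` meets `A ∩ X`. -/
theorem Subring.NicelyEssential.inf_restrictScalars_ne_bot (hA : A.NicelyEssential)
    {X : Submodule A S} {K : Submodule S S} (hK : K ≤ Submodule.span S (X : Set S))
    (hK0 : K ≠ ⊥) : A.selfSubmodule ⊓ X ⊓ K.restrictScalars A ≠ ⊥ := by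
  obtain ⟨x, hxK, hx⟩ := Submodule.exists_mem_ne_zero_of_ne_bot hK0
  obtain ⟨a, -, haA, haX, -, h0⟩ := hA.exists_mul_mem_s6 (hK hxK) (hK hxK) hx
  exact (Submodule.ne_bot_iff _).2 ⟨a * x, ⟨⟨haA, haX⟩, K.smul_mem a hxK⟩, h0⟩

theorem Subring.span_ne_bot {X : Submodule A S} (hX : X ≠ ⊥) :
    Submodule.span S (X : Set S) ≠ ⊥ := by
  obtain ⟨x, hxX, hx⟩ := Submodule.exists_mem_ne_zero_of_ne_bot hX
  exact (Submodule.ne_bot_iff _).2 ⟨x, Submodule.subset_span hxX, hx⟩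

end NicelyEssential

/-- Let `A` be a nicely essential subring of `S` and `L` a nonzero left
`A`-submodule of `S`. Then `A ∩ L` is a uniform left ideal of `A` iff the left ideal `SL`
of `S` generated by `L` is uniform, and `A ∩ L` is an essential left ideal of `A` iff `SL`
is an essential left ideal of `S`. -/
theorem stmt_6 {S : Type u} [Ring S] (A : Subring S) (hA : A.NicelyEssential)
    (L : Submodule A S) (hL : L ≠ ⊥) :
    (IsUniformSubmodule (A.selfSubmodule ⊓ L) ↔
      IsUniformSubmodule (Submodule.span S (L : Set S))) ∧
    (IsEssentialIn (A.selfSubmodule ⊓ L) A.selfSubmodule ↔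
      IsEssentialSubmodule (Submodule.span S (L : Set S))) := by
  refine ⟨⟨fun h => ⟨Subring.span_ne_bot hL, fun K M hK hM hK0 hM0 => ?_⟩,
    fun h => ⟨?_, fun K M hK hM hK0 hM0 => hA.inf_ne_bot ?_⟩⟩,
    fun h K hK0 => ?_, fun h => ⟨inf_le_left, fun K hK hK0 => ?_⟩⟩
  · obtain ⟨x, ⟨⟨-, hxK⟩, -, hxM⟩, hx⟩ := Submodule.exists_mem_ne_zero_of_ne_bot
      (h.2 _ _ inf_le_left inf_le_left (hA.inf_restrictScalars_ne_bot hK hK0)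
        (hA.inf_restrictScalars_ne_bot hM hM0))
    exact (Submodule.ne_bot_iff _).2 ⟨x, ⟨hxK, hxM⟩, hx⟩
  · exact fun h0 => hA.inf_restrictScalars_ne_bot le_rfl h.1 (by rw [h0, bot_inf_eq])
  · exact h.2 _ _ (Submodule.span_mono fun x hx => (hK hx).2)
      (Submodule.span_mono fun x hx => (hM hx).2)
      (Subring.span_ne_bot hK0) (Subring.span_ne_bot hM0)
  · have hKA : A.selfSubmodule ⊓ K.restrictScalars A ≠ ⊥ := fun h0 =>
      hA.inf_restrictScalars_ne_bot (X := K.restrictScalars A) Submodule.subset_span hK0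
        (by rw [h0, bot_inf_eq])
    obtain ⟨x, ⟨⟨-, hxL⟩, -, hxK⟩, hx⟩ :=
      Submodule.exists_mem_ne_zero_of_ne_bot (h.2 _ inf_le_left hKA)
    exact (Submodule.ne_bot_iff _).2 ⟨x, ⟨Submodule.subset_span hxL, hxK⟩, hx⟩
  · obtain ⟨x, ⟨hxL, hxK⟩, hx⟩ := Submodule.exists_mem_ne_zero_of_ne_bot
      (hA.inf_ne_bot (h _ (Subring.span_ne_bot hK0)))
    exact (Submodule.ne_bot_iff _).2 ⟨x, ⟨⟨hK hxK, hxL⟩, hxK⟩, hx⟩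
end

section
/- Let A be a nicely essential subring of a ring S. If S is left Goldie, then A is left Goldie. -/
universe u v

/-- The ascending chain condition on left annihilators passes to subrings. -/
theorem ACCLeftAnnihilators.subring {S : Type u} [Ring S] (A : Subring S)
    (hS : ACCLeftAnnihilators S) : ACCLeftAnnihilators A := by
  intro f hf hmono
  let V : ℕ → Set S := fun n => {u | ∃ v : A, (v : S) = u ∧ ∀ t ∈ f n, t * v = 0}
  have mem_iff : ∀ n (t : A), t ∈ f n ↔ (t : S) ∈ lAnnSet S (V n) := by
    intro n t
    constructor
    · rintro ht _ ⟨v, rfl, hv⟩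
      exact_mod_cast congrArg (Subtype.val) (hv t ht)
    · intro ht
      obtain ⟨U, hU⟩ := hf n
      rw [hU]
      intro u hu
      apply Subtype.ext
      refine ht u ⟨u, rfl, fun s hs => ?_⟩
      rw [hU] at hs
      exact hs u hu
  have hV : Monotone fun n => lAnnSet S (V n) := by
    rintro m n hmn t ht _ ⟨v, rfl, hv⟩
    exact ht v ⟨v, rfl, fun s hs => hv s (hmono hmn hs)⟩
  obtain ⟨n, hn⟩ := hS (fun n => lAnnSet S (V n)) (fun n => ⟨V n, rfl⟩) hV
  refine ⟨n, fun m hm => ?_⟩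
  ext t
  rw [mem_iff, mem_iff]
  exact (congrArg (fun I : Ideal S => (t : S) ∈ I) (hn m hm)).to_iff

/-- Nonzero elements of an independent family of left ideals of a nicely essential subring
generate independent left ideals of the ambient ring. -/
theorem Subring.NicelyEssential.iSupIndep_span_singleton {S : Type u} [Ring S] {A : Subring S}
    (hA : A.NicelyEssential) {ι : Type*} {f : ι → Ideal A} (hf : iSupIndep f) {x : ι → A}
    (hx : ∀ i, x i ∈ f i) : iSupIndep fun i => Ideal.span {(x i : S)} := by
  classical
  rw [iSupIndep_iff_finsetSum_eq_zero_imp_eq_zero] at hf ⊢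
  intro s v hv hsum i hi
  by_contra hne
  have hc : ∀ j, ∃ c : S, j ∈ s → c * x j = v j := by
    intro j
    by_cases hj : j ∈ s
    · obtain ⟨c, hc⟩ := Ideal.mem_span_singleton'.mp (hv j hj)
      exact ⟨c, fun _ => hc⟩
    · exact ⟨0, fun h => absurd h hj⟩
  choose c hc using hc
  obtain ⟨a, -, ha⟩ := hA ((insert (v i) (s.image c)).filter (· ≠ 0))
    fun y hy => (Finset.mem_filter.mp hy).2
  have hac : ∀ j ∈ s, a * c j ∈ A := by
    intro j hj
    by_cases h0 : c j = 0
    · simp [h0]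
    · exact (ha _ (Finset.mem_filter.mpr
        ⟨Finset.mem_insert_of_mem (Finset.mem_image_of_mem c hj), h0⟩)).1
  have hmul : ∀ j ∈ s, ∃ b : A, (b : S) = a * c j := fun j hj => ⟨⟨_, hac j hj⟩, rfl⟩
  choose! b hb using hmul
  have hbx : ∀ j ∈ s, ((b j * x j : A) : S) = a * v j := by
    intro j hj
    rw [Subring.coe_mul, hb j hj, mul_assoc, hc j hj]
  refine (ha (v i) (Finset.mem_filter.mpr ⟨Finset.mem_insert_self _ _, hne⟩)).2 ?_
  rw [← hbx i hi, hf s (fun j => b j * x j) (fun j _ => (f j).mul_mem_left _ (hx j)) ?_ i hi,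
    Subring.coe_zero]
  apply Subtype.ext
  rw [AddSubmonoidClass.coe_finsetSum, Finset.sum_congr rfl hbx, ← Finset.mul_sum, hsum, mul_zero,
    Subring.coe_zero]


/-- If `A` is a nicely essential subring of a left Goldie ring `S`,
then `A` is left Goldie. -/
theorem stmt_8 {S : Type u} [Ring S] (A : Subring S) (hA : A.NicelyEssential)
    (hS : IsLeftGoldie S) : IsLeftGoldie ↥A := by
  refine ⟨?_, hS.2.subring A⟩
  rintro ⟨f, hf, hne⟩
  choose x hx hx0 using fun n => Submodule.exists_mem_ne_zero_of_ne_bot (hne n)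
  refine hS.1 ⟨_, hA.iSupIndep_span_singleton hf hx, fun n => ?_⟩
  simpa [Ideal.span_singleton_eq_bot] using hx0 n
end

section
/- Let R be a ring, L an essential left ideal of R, and E a finite subset of R containing at least one nonzero element. Then there exists c ∈ R such that cE \ {0} is nonempty, is contained in L, and all elements of cE \ {0} have the same left annihilator in R. If moreover E contains an element a whose left annihilator in R is contained in ⋂_{x∈E} ann_R(x), then c can be chosen so that in addition c·a ≠ 0 and ⋂_{x∈E} ann_R(c·x) = ann_R(c·a). -/
universe u v

theorem mem_lAnn {R : Type u} [Ring R] {t x : R} : t ∈ lAnn R x ↔ t * x = 0 := Iff.rfl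

theorem IsEssentialSubmodule.exists_mul_mem {R : Type u} [Ring R] {L : Ideal R}
    (hL : IsEssentialSubmodule L) {x : R} (hx : x ≠ 0) : ∃ d : R, d * x ∈ L ∧ d * x ≠ 0 := by
  have h := hL (Ideal.span {x}) (by simpa [Ideal.span_singleton_eq_bot] using hx)
  obtain ⟨y, ⟨hyL, hyx⟩, hy⟩ := Submodule.exists_mem_ne_zero_of_ne_bot h
  obtain ⟨d, rfl⟩ := Ideal.mem_span_singleton'.1 hyx
  exact ⟨d, hyL, hy⟩

open Classical in
/-- The multiplier `c` minimizes the number of nonzero elements plus the number of elements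
outside `L` among all `c * x` with `x ∈ E`. -/
theorem IsEssentialSubmodule.exists_mul_mem_lAnn_eq {R : Type u} [Ring R] {L : Ideal R}
    (hL : IsEssentialSubmodule L) (E : Finset R) (hE : ∃ x ∈ E, x ≠ 0) :
    ∃ c : R,
      (∃ x ∈ E, c * x ≠ 0) ∧
      (∀ x ∈ E, c * x ∈ L) ∧
      (∀ x ∈ E, ∀ y ∈ E, c * x ≠ 0 → c * y ≠ 0 → lAnn R (c * x) = lAnn R (c * y)) := by
  let f : R → ℕ := fun c => (E.filter (fun x => c * x ≠ 0)).card +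
    (E.filter (fun x => c * x ∉ L)).card
  obtain ⟨c, hc, hmin⟩ := (measure f).wf.has_min {c : R | ∃ x ∈ E, c * x ≠ 0}
    ⟨1, by simpa using hE⟩
  have hsub_ne : ∀ b, E.filter (fun x => b * c * x ≠ 0) ⊆ E.filter (fun x => c * x ≠ 0) := by
    refine fun b => Finset.monotone_filter_right E fun x _ hx h => hx ?_
    rw [mul_assoc, h, mul_zero]
  have hsub_mem : ∀ b, E.filter (fun x => b * c * x ∉ L) ⊆ E.filter (fun x => c * x ∉ L) := by
    refine fun b => Finset.monotone_filter_right E fun x _ hx h => hx ?_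
    rw [mul_assoc]
    exact L.mul_mem_left b h
  have hann : ∀ x ∈ E, ∀ y ∈ E, c * x ≠ 0 → lAnn R (c * x) ≤ lAnn R (c * y) := by
    intro x hx y hy hcx b hb
    rw [mem_lAnn, ← mul_assoc] at hb ⊢
    by_contra hby
    refine hmin (b * c) ⟨y, hy, hby⟩ (add_lt_add_of_lt_of_le (Finset.card_lt_card ?_)
      (Finset.card_le_card (hsub_mem b)))
    refine (Finset.ssubset_iff_of_subset (hsub_ne b)).2 ⟨x, ?_, ?_⟩
    · simp [hx, hcx]
    · simp [hb]
  refine ⟨c, hc, fun x hx => ?_, fun x hx y hy hcx hcy =>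
    le_antisymm (hann x hx y hy hcx) (hann y hy x hx hcy)⟩
  by_contra hcx
  obtain ⟨d, hdL, hd⟩ := hL.exists_mul_mem (x := c * x) fun h => hcx (h ▸ L.zero_mem)
  rw [← mul_assoc] at hdL hd
  refine hmin (d * c) ⟨x, hx, hd⟩ (add_lt_add_of_le_of_lt (Finset.card_le_card (hsub_ne d))
    (Finset.card_lt_card ?_))
  refine (Finset.ssubset_iff_of_subset (hsub_mem d)).2 ⟨x, ?_, ?_⟩
  · simp [hx, hcx]
  · simp [hdL]

/-- Let `L` be an essential left ideal of `R` and `E` a finite subset of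
`R` containing a nonzero element. Then some `c ∈ R` makes `cE \ {0}` a nonempty subset of
`L` all of whose elements share the same left annihilator; and if `E` contains an element
`a` with `ann a ⊆ ⋂_{x ∈ E} ann x`, then `c` can moreover be chosen with `c·a ≠ 0` and
`⋂_{x ∈ E} ann (c·x) = ann (c·a)`. -/
theorem stmt_10 {R : Type u} [Ring R] (L : Ideal R) (hL : IsEssentialSubmodule L)
    (E : Finset R) (hE : ∃ x ∈ E, x ≠ 0) :
    (∃ c : R,
      (∃ x ∈ E, c * x ≠ 0) ∧
      (∀ x ∈ E, c * x ≠ 0 → c * x ∈ L) ∧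
      (∀ x ∈ E, ∀ y ∈ E, c * x ≠ 0 → c * y ≠ 0 → lAnn R (c * x) = lAnn R (c * y))) ∧
    (∀ a ∈ E, lAnn R a ≤ (⨅ x ∈ E, lAnn R x) →
      ∃ c : R,
        (∃ x ∈ E, c * x ≠ 0) ∧
        (∀ x ∈ E, c * x ≠ 0 → c * x ∈ L) ∧
        (∀ x ∈ E, ∀ y ∈ E, c * x ≠ 0 → c * y ≠ 0 → lAnn R (c * x) = lAnn R (c * y)) ∧
        c * a ≠ 0 ∧ (⨅ x ∈ E, lAnn R (c * x)) = lAnn R (c * a)) := by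
  obtain ⟨c, hc, hcL, hann⟩ := hL.exists_mul_mem_lAnn_eq E hE
  refine ⟨⟨c, hc, fun x hx _ => hcL x hx, hann⟩, fun a ha hle =>
    ⟨c, hc, fun x hx _ => hcL x hx, hann, fun hca => ?_, ?_⟩⟩
  · obtain ⟨x, hx, hcx⟩ := hc
    exact hcx ((hle.trans (iInf₂_le x hx)) hca)
  · refine le_antisymm (iInf₂_le a ha) (le_iInf₂ fun x hx b hb => ?_)
    rw [mem_lAnn, ← mul_assoc] at hb ⊢
    exact (hle.trans (iInf₂_le x hx)) hb
end

section
/- Let R be a (not necessarily commutative) ring, σ a type, S = AddMonoidAlgebra R (σ →₀ ℕ), and A any subring of S. If (L_i)_{i∈I} is an independent family of left ideals of R (i.e., the sum of the L_i is direct), then (A ∩ A·L_i)_{i∈I} is an independent family of left ideals of A, where A·L_i denotes the left A-submodule of S generated by L_i. -/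
universe u v

namespace AddMonoidAlgebra

variable {R : Type*} [Ring R] {G : Type*} [AddMonoid G]

/-- The elements of `R[G]` all of whose coefficients lie in the left ideal `I`, as a left module
over a subring `A` of `R[G]`. -/
def coeffSubmodule (A : Subring (AddMonoidAlgebra R G)) (I : Ideal R) :
    Submodule A (AddMonoidAlgebra R G) where
  carrier := {x | ∀ g, x.coeff g ∈ I}
  add_mem' hx hy g := I.add_mem (hx g) (hy g)
  zero_mem' _ := I.zero_mem
  smul_mem' := by
    classical
    intro a x hx g
    change ((a : AddMonoidAlgebra R G) * x).coeff g ∈ I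
    rw [coeff_mul]
    refine I.sum_mem fun g₁ _ => I.sum_mem fun g₂ _ => ?_
    dsimp only
    split_ifs
    · exact I.mul_mem_left _ (hx g₂)
    · exact I.zero_mem

theorem coeffSubmodule_mono (A : Subring (AddMonoidAlgebra R G)) :
    Monotone (coeffSubmodule A) :=
  fun _ _ h _ hx g => h (hx g)

theorem span_single_zero_le_coeffSubmodule (A : Subring (AddMonoidAlgebra R G)) (I : Ideal R) :
    Submodule.span A ((fun r : R => single (0 : G) r) '' (I : Set R)) ≤ coeffSubmodule A I := by
  classical
  rw [Submodule.span_le]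
  rintro _ ⟨r, hr, rfl⟩ g
  rw [coeff_single, Finsupp.single_apply]
  split_ifs
  · exact hr
  · exact I.zero_mem

theorem disjoint_coeffSubmodule (A : Subring (AddMonoidAlgebra R G)) {I J : Ideal R}
    (h : Disjoint I J) : Disjoint (coeffSubmodule A I) (coeffSubmodule A J) := by
  rw [Submodule.disjoint_def] at h ⊢
  intro x hI hJ
  ext g
  exact h _ (hI g) (hJ g)

theorem iSupIndep_coeffSubmodule (A : Subring (AddMonoidAlgebra R G)) {ι : Type*}
    {L : ι → Ideal R} (hL : iSupIndep L) : iSupIndep fun i => coeffSubmodule A (L i) :=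
  fun i => (disjoint_coeffSubmodule A (hL i)).mono_right <|
    iSup₂_le fun j hj => coeffSubmodule_mono A (le_iSup₂_of_le j hj le_rfl)

end AddMonoidAlgebra

/-- Let `S = AddMonoidAlgebra R (σ →₀ ℕ)` and `A` a subring of `S`. Any
independent family `(L i)` of left ideals of `R` induces an independent family
`(A ∩ A·(L i))` of left ideals of `A`. -/
theorem stmt_12 {R : Type u} [Ring R] {σ : Type v}
    (A : Subring (AddMonoidAlgebra R (σ →₀ ℕ))) {ι : Type w} (L : ι → Ideal R)
    (hL : iSupIndep L) :
    iSupIndep (fun i : ι => A.selfSubmodule ⊓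
      Submodule.span A
        ((fun r : R => AddMonoidAlgebra.single (0 : σ →₀ ℕ) r) '' (L i : Set R))) :=
  (AddMonoidAlgebra.iSupIndep_coeffSubmodule A hL).mono fun i =>
    inf_le_right.trans (AddMonoidAlgebra.span_single_zero_le_coeffSubmodule A (L i))
end

section
/- Let R be a (not necessarily commutative) ring satisfying the ascending chain condition on left annihilators, σ a type, T an additive submonoid of the free abelian group (σ →₀ ℤ), and A = AddMonoidAlgebra R T. If R is prime then A is prime; if R is semiprime then A is semiprime. -/
universe u v

section PrimeElements

variable {S : Type u} [Ring S]

/-- The right annihilator of the right ideal `a S`, as a two-sided ideal. -/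
def rightAnnihilator (a : S) : TwoSidedIdeal S :=
  .mk' {y | ∀ r, a * r * y = 0} (by simp)
    (fun hx hy r => by rw [mul_add, hx r, hy r, add_zero])
    (fun hx r => by rw [mul_neg, hx r, neg_zero])
    (fun {x y} hy r => by rw [← mul_assoc, mul_assoc a, hy])
    (fun {x y} hx r => by rw [← mul_assoc, hx, zero_mul])

theorem mem_rightAnnihilator {a y : S} :
    y ∈ rightAnnihilator a ↔ ∀ r, a * r * y = 0 :=
  TwoSidedIdeal.mem_mk' _ _ _ _ _ _ _

/-- The left annihilator of a two-sided ideal, as a two-sided ideal. -/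
def leftAnnihilator (J : TwoSidedIdeal S) : TwoSidedIdeal S :=
  .mk' {x | ∀ y ∈ J, x * y = 0} (by simp)
    (fun hx hy z hz => by rw [add_mul, hx z hz, hy z hz, add_zero])
    (fun hx z hz => by rw [neg_mul, hx z hz, neg_zero])
    (fun {x y} hy z hz => by rw [mul_assoc, hy z hz, mul_zero])
    (fun {x y} hx z hz => by rw [mul_assoc, hx _ (J.mul_mem_left _ _ hz)])

theorem mem_leftAnnihilator {J : TwoSidedIdeal S} {x : S} :
    x ∈ leftAnnihilator J ↔ ∀ y ∈ J, x * y = 0 :=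
  TwoSidedIdeal.mem_mk' _ _ _ _ _ _ _

theorem mem_leftAnnihilator_rightAnnihilator (a : S) :
    a ∈ leftAnnihilator (rightAnnihilator a) :=
  mem_leftAnnihilator.2 fun y hy => by simpa using mem_rightAnnihilator.1 hy 1

theorem IsPrimeRing.eq_zero_or_eq_zero (h : IsPrimeRing S) {a b : S}
    (hab : ∀ r, a * r * b = 0) : a = 0 ∨ b = 0 := by
  have hb : b ∈ rightAnnihilator a := mem_rightAnnihilator.2 hab
  have ha := mem_leftAnnihilator_rightAnnihilator a
  refine (h _ (rightAnnihilator a) fun x hx y hy =>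
    mem_leftAnnihilator.1 hx y hy).imp (fun h0 => ?_) fun h0 => ?_
  · rwa [h0, TwoSidedIdeal.mem_bot] at ha
  · rwa [h0, TwoSidedIdeal.mem_bot] at hb

theorem IsSemiprimeRing.eq_zero (h : IsSemiprimeRing S) {a : S}
    (haa : ∀ r, a * r * a = 0) : a = 0 := by
  have ha : a ∈ leftAnnihilator (rightAnnihilator a) ⊓ rightAnnihilator a :=
    (TwoSidedIdeal.mem_inf S).2
      ⟨mem_leftAnnihilator_rightAnnihilator a, mem_rightAnnihilator.2 haa⟩
  rwa [h _ fun x hx y hy => mem_leftAnnihilator.1 ((TwoSidedIdeal.mem_inf S).1 hx).1 y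
    ((TwoSidedIdeal.mem_inf S).1 hy).2, TwoSidedIdeal.mem_bot] at ha

end PrimeElements

section LeadingCoefficients

/-- A free abelian group embeds additively into a linearly ordered cancellative group, so every
nonzero element of the monoid algebra of a submonoid has a leading coefficient; these coefficients
are multiplicative along products with an inserted scalar. -/
theorem exists_leadingCoeff {R : Type u} [Ring R] {σ : Type v} (T : AddSubmonoid (σ →₀ ℤ)) :
    ∃ lc : AddMonoidAlgebra R T → R, (∀ x, lc x = 0 → x = 0) ∧
      ∀ x y r, x * AddMonoidAlgebra.single 0 r * y = 0 → lc x * r * lc y = 0 := by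
  classical
  let _ : LinearOrder σ := linearOrderOfSTO WellOrderingRel
  let D : T → Lex (σ →₀ ℤ) := fun t => toLex t.1
  have hD : ∀ s t, D (s + t) = D s + D t := fun _ _ => rfl
  have hinj : D.Injective := fun s t h => Subtype.ext (toLex.injective h)
  have hmax : ∀ x : AddMonoidAlgebra R T, ∃ t : T, (x.coeff t = 0 → x = 0) ∧
      ∀ s ∈ x.coeff.support, D s ≤ D t := fun x => by
    by_cases hx : x = 0
    · exact ⟨0, by simp [hx], by simp [hx]⟩
    · have hne : x.coeff.support.Nonempty := by
        simpa [Finset.nonempty_iff_ne_empty] using hx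
      obtain ⟨t, ht, hts⟩ := x.coeff.support.exists_max_image D hne
      exact ⟨t, fun h => absurd h (Finsupp.mem_support_iff.1 ht), hts⟩
  choose deg hdeg hle using hmax
  refine ⟨fun x => x.coeff (deg x), hdeg, fun x y r hxy => ?_⟩
  have huniq : UniqueAdd (x * AddMonoidAlgebra.single 0 r).coeff.support y.coeff.support
      (deg x) (deg y) := fun s t hs ht hst => by
    have hs' : D s ≤ D (deg x) := hle x s <| Finsupp.mem_support_iff.2 fun h0 => by
      simp [AddMonoidAlgebra.coeff_mul_single_zero, h0] at hs
    have ht' : D t ≤ D (deg y) := hle y t ht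
    have hsum : D s + D t = D (deg x) + D (deg y) := by rw [← hD, ← hD, hst]
    exact ((add_eq_add_iff_eq_and_eq hs' ht').1 hsum).imp (@hinj _ _) (@hinj _ _)
  have h := AddMonoidAlgebra.coeff_mul_add_of_uniqueAdd huniq
  rw [hxy, AddMonoidAlgebra.coeff_mul_single_zero] at h
  simpa using h.symm

end LeadingCoefficients

/-- Let `R` satisfy the ACC on left annihilators, `T` an additive
submonoid of the free abelian group `σ →₀ ℤ`, and `A = AddMonoidAlgebra R T`. If `R` is
prime then `A` is prime; if `R` is semiprime then `A` is semiprime. -/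
theorem stmt_15 {R : Type u} [Ring R] {σ : Type v} (T : AddSubmonoid (σ →₀ ℤ))
    (hR : ACCLeftAnnihilators R) :
    (IsPrimeRing R → IsPrimeRing (AddMonoidAlgebra R T)) ∧
    (IsSemiprimeRing R → IsSemiprimeRing (AddMonoidAlgebra R T)) := by
  obtain ⟨lc, hlc, hmul⟩ := exists_leadingCoeff (R := R) T
  refine ⟨fun h I J hIJ => ?_, fun h I hI => ?_⟩
  · by_contra! hne
    obtain ⟨x, hx, hx0⟩ : ∃ x ∈ I, x ≠ 0 := by
      by_contra! hI
      exact hne.1 (eq_bot_iff.2 fun x hx => hI x hx)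
    obtain ⟨y, hy, hy0⟩ : ∃ y ∈ J, y ≠ 0 := by
      by_contra! hJ
      exact hne.2 (eq_bot_iff.2 fun y hy => hJ y hy)
    exact (h.eq_zero_or_eq_zero fun r => hmul x y r (hIJ _ (I.mul_mem_right _ _ hx) y hy)).elim
      (fun h0 => hx0 (hlc x h0)) fun h0 => hy0 (hlc y h0)
  · exact eq_bot_iff.2 fun x hx =>
      hlc x (h.eq_zero fun r => hmul x x r (hI _ (I.mul_mem_right _ _ hx) x hx))
end
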